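/- Let ℓ ≥ 0 and n ≥ 0 be integers and let a_1,…,a_ℓ be integers with a_i ≥ 2 for each i, and set k = n + ∑_{i=1}^{ℓ} a_i, with k ≥ 1. Then there exists a constant C = C(k) > 0 such that for all real x ≥ 3, |∑ 1/(q_1⋯q_n·∏_{i=1}^{ℓ} p_i^{a_i}) − S_n(x)·∏_{i=1}^{ℓ} P(a_i)| ≤ C·(log log x)^{n−1}/log x, where the first sum ranges over all (n+ℓ)-tuples of primes (q_1,…,q_n, p_1,…,p_ℓ) (not necessarily distinct) satisfying q_1⋯q_n·∏_{i=1}^{ℓ} p_i^{a_i} ≤ x. -/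

import Mathlib

open scoped Classical

/-- The Mertens constant `β = γ + ∑_p (1/p + log(1 - 1/p))`. -/
noncomputable def mertensBeta : ℝ :=
  Real.eulerMascheroniConstant + ∑' p : Nat.Primes, (1/(p:ℝ) + Real.log (1 - 1/(p:ℝ)))

/-- The prime zeta function `P(j) = ∑_p p^{-j}` at a positive integer `j`. -/
noncomputable def primeZeta (j : ℕ) : ℝ := ∑' p : Nat.Primes, 1/(p:ℝ)^j

/-- The (real) value of the Riemann zeta function at an integer `j ≥ 2`. -/
noncomputable def zetaVal (j : ℕ) : ℝ := (riemannZeta (j : ℂ)).re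

/-- `S_k(x) = ∑_{p_1 ⋯ p_k ≤ x} 1/(p_1 ⋯ p_k)`, the sum over ordered `k`-tuples of primes
with product at most `x` (so `S_0(x) = 1` for `x ≥ 1`). -/
noncomputable def Sord (k : ℕ) (x : ℝ) : ℝ :=
  ∑' p : Fin k → Nat.Primes,
    if ((∏ i, (p i : ℕ) : ℕ) : ℝ) ≤ x then (1:ℝ) / (∏ i, ((p i : ℕ) : ℝ)) else 0

/-- A form of Chebyshev's bound on a dyadic block. -/
lemma sum_log_div_prime_dyadic_block_le (F : Finset Nat.Primes) {w : ℝ} (hw : 0 < w)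
    (hF : ∀ q ∈ F, w < (q : ℝ) ∧ (q : ℝ) ≤ 2 * w) :
    ∑ q ∈ F, Real.log q / (q : ℝ) ≤ 2 * Real.log 4 := by
  have htheta : ∑ q ∈ F, Real.log (q : ℝ) ≤ Chebyshev.theta (2 * w) := by
    rw [Chebyshev.theta_eq_sum_Icc]
    refine (Finset.sum_map F ⟨fun q : Nat.Primes => (q : ℕ), Subtype.val_injective⟩
      (fun n : ℕ => Real.log n)).symm.trans_le ?_
    refine Finset.sum_le_sum_of_subset_of_nonneg ?_ fun i _ _ => Real.log_natCast_nonneg i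
    intro n hn
    obtain ⟨q, hq, rfl⟩ := Finset.mem_map.1 hn
    simp only [Finset.mem_filter, Finset.mem_Icc, zero_le, true_and]
    exact ⟨Nat.le_floor (hF q hq).2, q.2⟩
  calc ∑ q ∈ F, Real.log q / (q : ℝ)
      ≤ ∑ q ∈ F, Real.log q / w := by
        refine Finset.sum_le_sum fun q hq => ?_
        exact div_le_div_of_nonneg_left (Real.log_natCast_nonneg _) hw (hF q hq).1.le
    _ = (∑ q ∈ F, Real.log (q : ℝ)) / w := by rw [Finset.sum_div]
    _ ≤ Real.log 4 * (2 * w) / w := by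
        gcongr
        exact htheta.trans (Chebyshev.theta_le_log4_mul_x (by positivity))
    _ = 2 * Real.log 4 := by field_simp

lemma sum_log_div_prime_le_of_two_pow (J : ℕ) (F : Finset Nat.Primes) {u : ℝ} (hu : 0 < u)
    (hF : ∀ q ∈ F, u < (q : ℝ) ∧ (q : ℝ) ≤ 2 ^ J * u) :
    ∑ q ∈ F, Real.log q / (q : ℝ) ≤ J * (2 * Real.log 4) := by
  induction J generalizing F with
  | zero =>
    have : F = ∅ := Finset.eq_empty_of_forall_notMem fun q hq => by
      have := hF q hq
      simp only [pow_zero, one_mul] at this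
      linarith
    simp [this]
  | succ J ih =>
    rw [← Finset.sum_filter_add_sum_filter_not F (fun q : Nat.Primes => (q : ℝ) ≤ 2 ^ J * u)]
    have h1 := ih (F.filter fun q : Nat.Primes => (q : ℝ) ≤ 2 ^ J * u) fun q hq => by
      rw [Finset.mem_filter] at hq
      exact ⟨(hF q hq.1).1, hq.2⟩
    have h2 := sum_log_div_prime_dyadic_block_le
      (F.filter fun q : Nat.Primes => ¬ (q : ℝ) ≤ 2 ^ J * u) (w := 2 ^ J * u) (by positivity)
      fun q hq => by
        rw [Finset.mem_filter, not_le] at hq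
        refine ⟨hq.2, (hF q hq.1).2.trans_eq (by ring)⟩
    push_cast
    linarith

lemma sum_log_div_prime_le (F : Finset Nat.Primes) {u m : ℝ} (hu : 0 < u) (hm : 1 ≤ m)
    (hF : ∀ q ∈ F, u < (q : ℝ) ∧ (q : ℝ) ≤ m * u) :
    ∑ q ∈ F, Real.log q / (q : ℝ) ≤ 4 * Real.log m + 4 * Real.log 2 := by
  have hl2 : 0 < Real.log 2 := Real.log_pos one_lt_two
  have hl : 0 ≤ Real.logb 2 m := Real.logb_nonneg one_lt_two hm
  have hJ : m ≤ 2 ^ ⌈Real.logb 2 m⌉₊ := by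
    rw [← Real.rpow_natCast, ← Real.logb_le_iff_le_rpow one_lt_two (by linarith)]
    exact Nat.le_ceil _
  refine (sum_log_div_prime_le_of_two_pow ⌈Real.logb 2 m⌉₊ F hu fun q hq =>
    ⟨(hF q hq).1, (hF q hq).2.trans (by gcongr)⟩).trans ?_
  have h4 : Real.log 4 = 2 * Real.log 2 := by
    rw [show (4 : ℝ) = 2 ^ 2 by norm_num, Real.log_pow]; norm_num
  calc (⌈Real.logb 2 m⌉₊ : ℝ) * (2 * Real.log 4)
      ≤ (Real.logb 2 m + 1) * (2 * Real.log 4) := by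
        gcongr
        exact (Nat.ceil_lt_add_one hl).le
    _ = 4 * Real.log m + 4 * Real.log 2 := by
        rw [h4, Real.logb]; field_simp; ring

lemma sum_one_div_prime_le_of_two_pow_two_pow (j : ℕ) (F : Finset Nat.Primes)
    (hF : ∀ q ∈ F, (q : ℝ) ≤ 2 ^ 2 ^ j) : ∑ q ∈ F, 1 / (q : ℝ) ≤ 1 + 8 * j := by
  induction j generalizing F with
  | zero =>
    set two : Nat.Primes := ⟨2, Nat.prime_two⟩
    have hsub : F ⊆ {two} := fun q hq => by
      have h := hF q hq
      simp only [pow_zero, pow_one] at h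
      have h' : (q : ℕ) ≤ 2 := by exact_mod_cast h
      exact Finset.mem_singleton.2 (Subtype.ext (le_antisymm h' q.2.two_le))
    refine (Finset.sum_le_sum_of_subset_of_nonneg hsub fun _ _ _ => by positivity).trans ?_
    rw [Finset.sum_singleton]
    change 1 / ((2 : ℕ) : ℝ) ≤ _
    norm_num
  | succ j ih =>
    have hl2 : 0 < Real.log 2 := Real.log_pos one_lt_two
    have hu1 : (2 : ℝ) ≤ 2 ^ 2 ^ j := le_self_pow₀ one_le_two (by positivity)
    have hlu : Real.log 2 ≤ Real.log (2 ^ 2 ^ j) := Real.log_le_log two_pos hu1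
    have hlu0 := hl2.trans_le hlu
    rw [← Finset.sum_filter_add_sum_filter_not F (fun q : Nat.Primes => (q : ℝ) ≤ 2 ^ 2 ^ j)]
    have h1 := ih (F.filter fun q : Nat.Primes => (q : ℝ) ≤ 2 ^ 2 ^ j) fun q hq =>
      (Finset.mem_filter.1 hq).2
    have h2 := sum_log_div_prime_le
      (F.filter fun q : Nat.Primes => ¬ (q : ℝ) ≤ 2 ^ 2 ^ j) (u := 2 ^ 2 ^ j) (m := 2 ^ 2 ^ j)
      (by positivity) (by linarith) fun q hq => by
        rw [Finset.mem_filter, not_le] at hq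
        exact ⟨hq.2, (hF q hq.1).trans_eq (by rw [pow_succ 2 j, mul_two, pow_add])⟩
    have h3 : Real.log (2 ^ 2 ^ j) *
        ∑ q ∈ F.filter (fun q : Nat.Primes => ¬ (q : ℝ) ≤ 2 ^ 2 ^ j), 1 / (q : ℝ) ≤
        ∑ q ∈ F.filter (fun q : Nat.Primes => ¬ (q : ℝ) ≤ 2 ^ 2 ^ j), Real.log q / (q : ℝ) := by
      rw [Finset.mul_sum]
      refine Finset.sum_le_sum fun q hq => ?_
      rw [Finset.mem_filter, not_le] at hq
      rw [mul_one_div]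
      gcongr
      exact hq.2.le
    have h4 : ∑ q ∈ F.filter (fun q : Nat.Primes => ¬ (q : ℝ) ≤ 2 ^ 2 ^ j), 1 / (q : ℝ) ≤ 8 := by
      refine le_of_mul_le_mul_left ?_ hlu0
      linarith
    push_cast
    linarith

lemma log_log_three_pos : 0 < Real.log (Real.log 3) := by
  refine Real.log_pos ?_
  rw [Real.lt_log_iff_exp_lt (by norm_num)]
  linarith [Real.exp_one_lt_d9]

lemma one_lt_log_of_three_le {x : ℝ} (hx : 3 ≤ x) : 1 < Real.log x := by
  rw [Real.lt_log_iff_exp_lt (by linarith)]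
  linarith [Real.exp_one_lt_d9]

/-- The upper bound in Mertens' second theorem, up to a constant factor. -/
lemma exists_sum_one_div_prime_le_log_log :
    ∃ C : ℝ, 0 < C ∧ ∀ x : ℝ, 3 ≤ x → ∀ F : Finset Nat.Primes, (∀ q ∈ F, (q : ℝ) ≤ x) →
      ∑ q ∈ F, 1 / (q : ℝ) ≤ C * Real.log (Real.log x) := by
  have hl2 : 0 < Real.log 2 := Real.log_pos one_lt_two
  set A : ℝ := 9 + 8 * |Real.log (Real.log 2)| / Real.log 2
  have hA : 0 < A := by positivity
  refine ⟨A / Real.log (Real.log 3) + 8 / Real.log 2, ?_, fun x hx F hF => ?_⟩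
  · have := log_log_three_pos
    positivity
  have h3 := log_log_three_pos
  have hL : Real.log (Real.log 3) ≤ Real.log (Real.log x) := by
    refine Real.log_le_log (by linarith [one_lt_log_of_three_le le_rfl]) ?_
    exact Real.log_le_log (by norm_num) hx
  have hlx := one_lt_log_of_three_le hx
  have hb : 1 ≤ Real.logb 2 x := by
    rw [Real.le_logb_iff_rpow_le one_lt_two (by linarith)]
    norm_num; linarith
  set y := Real.logb 2 (Real.logb 2 x) with hy
  have hy0 : 0 ≤ y := Real.logb_nonneg one_lt_two hb
  have hxj : x ≤ 2 ^ 2 ^ ⌈y⌉₊ := by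
    rw [← Real.rpow_natCast, ← Real.logb_le_iff_le_rpow one_lt_two (by linarith)]
    push_cast
    rw [← Real.rpow_natCast, ← Real.logb_le_iff_le_rpow one_lt_two (by linarith)]
    exact Nat.le_ceil _
  have h1 := sum_one_div_prime_le_of_two_pow_two_pow ⌈y⌉₊ F fun q hq => (hF q hq).trans hxj
  have h2 : (⌈y⌉₊ : ℝ) ≤ y + 1 := (Nat.ceil_lt_add_one hy0).le
  have hyeq : y = (Real.log (Real.log x) - Real.log (Real.log 2)) / Real.log 2 := by
    rw [hy, Real.logb, Real.logb, Real.log_div (by linarith) hl2.ne']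
  have h5 : y ≤ Real.log (Real.log x) / Real.log 2 + |Real.log (Real.log 2)| / Real.log 2 := by
    rw [hyeq, ← add_div]
    gcongr
    linarith [neg_abs_le (Real.log (Real.log 2))]
  have h6 : A ≤ A / Real.log (Real.log 3) * Real.log (Real.log x) := by
    rw [div_mul_eq_mul_div, le_div_iff₀ h3]
    gcongr
  calc _ ≤ A + 8 / Real.log 2 * Real.log (Real.log x) := by
        have : 8 / Real.log 2 * Real.log (Real.log x) = 8 * (Real.log (Real.log x) / Real.log 2) := by
          ring
        rw [this]
        simp only [A, mul_div_assoc]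
        linarith
    _ ≤ _ := by rw [add_mul]; linarith

lemma hasSum_pi_prod_of_nonneg {ι : Type*} {l : ℕ} (f : Fin l → ι → ℝ)
    (hf : ∀ i, Summable (f i)) (h0 : ∀ i p, 0 ≤ f i p) :
    HasSum (fun p : Fin l → ι => ∏ i, f i (p i)) (∏ i, ∑' p, f i p) := by
  induction l with
  | zero => simp [hasSum_unique]
  | succ l ih =>
    set g : (Fin l → ι) → ℝ := fun p => ∏ i, f i.succ (p i) with hg
    have ih' : HasSum g (∏ i : Fin l, ∑' p, f i.succ p) :=
      ih (fun i => f i.succ) (fun i => hf _) (fun i p => h0 _ _)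
    have hg0 : 0 ≤ g := fun p => Finset.prod_nonneg fun i _ => h0 _ _
    let e : ι × (Fin l → ι) ≃ (Fin (l + 1) → ι) := Fin.consEquiv fun _ => ι
    have hs : Summable fun z : ι × (Fin l → ι) => f 0 z.1 * g z.2 :=
      Summable.mul_of_nonneg (hf 0) ih'.summable (h0 0) hg0
    have hfg : (fun p : Fin (l + 1) → ι => ∏ i, f i (p i)) ∘ e = fun z => f 0 z.1 * g z.2 := by
      funext z
      simp [Fin.prod_univ_succ, e, Fin.consEquiv, hg]
    rw [Fin.prod_univ_succ, ← e.hasSum_iff, hfg]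
    exact (hf 0).hasSum.mul ih' hs

lemma prod_one_div_nonneg {n : ℕ} (q : Fin n → Nat.Primes) : 0 ≤ ∏ i, 1 / (q i : ℝ) :=
  Finset.prod_nonneg fun _ _ => by positivity

lemma sum_log_mul_prod_one_div_le {n : ℕ} (i : Fin (n + 1)) (F : Finset Nat.Primes) {x m : ℝ}
    (hx : 0 < x) (hm : 1 ≤ m) :
    ∑ q ∈ (Fintype.piFinset fun _ : Fin (n + 1) => F).filter
        (fun q => ∏ j, (q j : ℝ) ≤ x ∧ x < (∏ j, (q j : ℝ)) * m),
      Real.log (q i) * ∏ j, 1 / (q j : ℝ) ≤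
      (∑ q ∈ F, 1 / (q : ℝ)) ^ n * (4 * Real.log m + 4 * Real.log 2) := by
  have hpos : ∀ r : Fin n → Nat.Primes, 0 < ∏ j, (r j : ℝ) := fun r =>
    Finset.prod_pos fun j _ => by exact_mod_cast (r j).2.pos
  let e : Nat.Primes × (Fin n → Nat.Primes) ≃ (Fin (n + 1) → Nat.Primes) :=
    Fin.insertNthEquiv (fun _ => Nat.Primes) i
  have he : ∀ z, e z i = z.1 := fun z => by simp [e]
  have he' : ∀ z j, e z (i.succAbove j) = z.2 j := fun z j => by simp [e]
  rw [Finset.sum_filter]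
  have hmap : (∑ q ∈ Fintype.piFinset fun _ : Fin (n + 1) => F,
      if (∏ j, (q j : ℝ) ≤ x ∧ x < (∏ j, (q j : ℝ)) * m) then
        Real.log (q i) * ∏ j, 1 / (q j : ℝ) else 0) =
      ∑ z ∈ F ×ˢ Fintype.piFinset fun _ : Fin n => F,
        if (z.1 : ℝ) * ∏ j, (z.2 j : ℝ) ≤ x ∧ x < ((z.1 : ℝ) * ∏ j, (z.2 j : ℝ)) * m then
          Real.log z.1 * (1 / (z.1 : ℝ) * ∏ j, 1 / (z.2 j : ℝ)) else 0 := by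
    symm
    refine Finset.sum_equiv e (fun z => ?_) fun z _ => ?_
    · simp only [Finset.mem_product, Fintype.mem_piFinset, Fin.forall_iff_succAbove i, he, he']
    · simp only [Fin.prod_univ_succAbove _ i, he, he']
  rw [hmap, Finset.sum_product_right, Finset.sum_pow', Finset.sum_mul]
  refine Finset.sum_le_sum fun r _ => ?_
  have hR := hpos r
  rw [← Finset.sum_filter]
  calc _ = (∏ j, 1 / (r j : ℝ)) * ∑ q ∈ F.filter (fun q : Nat.Primes =>
          (q : ℝ) * ∏ j, (r j : ℝ) ≤ x ∧ x < ((q : ℝ) * ∏ j, (r j : ℝ)) * m),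
          Real.log q / (q : ℝ) := by
        rw [Finset.mul_sum]
        refine Finset.sum_congr rfl fun q _ => by ring
    _ ≤ _ := by
        refine mul_le_mul_of_nonneg_left ?_ (prod_one_div_nonneg r)
        have hm0 : 0 < m := by linarith
        refine sum_log_div_prime_le _ (u := x / ((∏ j, (r j : ℝ)) * m)) (by positivity) hm
          fun q hq => ?_
        obtain ⟨-, h1, h2⟩ := Finset.mem_filter.1 hq
        constructor
        · rw [div_lt_iff₀ (by positivity)]
          linarith
        · rw [show m * (x / ((∏ j, (r j : ℝ)) * m)) = x / ∏ j, (r j : ℝ) by field_simp,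
            le_div_iff₀ hR]
          exact h1

/-- Short sums of `1 / (q₁ ⋯ qₙ)` over `x / m < q₁ ⋯ qₙ ≤ x`. -/
lemma exists_sum_prod_one_div_le (n : ℕ) :
    ∃ C : ℝ, 0 < C ∧ ∀ x m : ℝ, 3 ≤ x → 1 ≤ m → ∀ F : Finset Nat.Primes,
      (∀ q ∈ F, (q : ℝ) ≤ x) →
      ∑ q ∈ (Fintype.piFinset fun _ : Fin n => F).filter
          (fun q => ∏ j, (q j : ℝ) ≤ x ∧ x < (∏ j, (q j : ℝ)) * m), ∏ j, 1 / (q j : ℝ) ≤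
        C * (Real.log (Real.log x)) ^ ((n : ℝ) - 1) / Real.log x * m ^ (1 / 4 : ℝ) := by
  obtain ⟨B, hB, hT⟩ := exists_sum_one_div_prime_le_log_log
  have hl2 : 0 < Real.log 2 := Real.log_pos one_lt_two
  refine ⟨B ^ n * 256 + 2 * n * B ^ (n - 1) * (16 + 4 * Real.log 2), ?_,
    fun x m hx hm F hF => ?_⟩
  · positivity
  have hlx := one_lt_log_of_three_le hx
  have hL : 0 < Real.log (Real.log x) := Real.log_pos hlx
  have hx0 : 0 < x := by linarith
  have hm0 : 0 < m := by linarith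
  have hTF := hT x hx F hF
  have hT0 : 0 ≤ ∑ q ∈ F, 1 / (q : ℝ) := Finset.sum_nonneg fun _ _ => by positivity
  have hm4 : 1 ≤ m ^ (1 / 4 : ℝ) := Real.one_le_rpow hm (by norm_num)
  set L := Real.log (Real.log x) with hLdef
  set T := ∑ q ∈ F, 1 / (q : ℝ)
  set G := (Fintype.piFinset fun _ : Fin n => F).filter
    (fun q => ∏ j, (q j : ℝ) ≤ x ∧ x < (∏ j, (q j : ℝ)) * m)
  rw [div_mul_eq_mul_div, le_div_iff₀ (by linarith)]
  have hP : 0 < L ^ ((n : ℝ) - 1) := Real.rpow_pos_of_pos hL _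
  have hLn : L ^ n = L ^ ((n : ℝ) - 1) * L := by
    rw [← Real.rpow_natCast, ← Real.rpow_add_one hL.ne']
    congr 1; ring
  rcases lt_or_ge x (m ^ 2) with hxm | hxm
  · have h1 : ∑ q ∈ G, ∏ j, 1 / (q j : ℝ) ≤ (B * L) ^ n := by
      calc _ ≤ ∑ q ∈ Fintype.piFinset fun _ : Fin n => F, ∏ j, 1 / (q j : ℝ) :=
            Finset.sum_le_sum_of_subset_of_nonneg (Finset.filter_subset _ _)
              fun q _ _ => prod_one_div_nonneg q
        _ = T ^ n := (Finset.sum_pow' F (fun q => 1 / (q : ℝ)) n).symm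
        _ ≤ _ := by gcongr
    have h2 : L * Real.log x ≤ 256 * m ^ (1 / 4 : ℝ) := by
      have h3 : Real.log x ≤ 16 * x ^ (1 / 16 : ℝ) := by
        have := Real.log_le_rpow_div hx0.le (ε := 1 / 16) (by norm_num)
        linarith
      have h4 : x ^ (1 / 16 : ℝ) * x ^ (1 / 16 : ℝ) ≤ m ^ (1 / 4 : ℝ) := by
        rw [← Real.rpow_add hx0]
        calc x ^ (1 / 16 + 1 / 16 : ℝ) ≤ (m ^ 2) ^ (1 / 16 + 1 / 16 : ℝ) := by gcongr
          _ = _ := by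
            rw [← Real.rpow_natCast, ← Real.rpow_mul hm0.le]; norm_num
      have h5 : L ≤ Real.log x := Real.log_le_self (by linarith)
      calc L * Real.log x ≤ (16 * x ^ (1 / 16 : ℝ)) * (16 * x ^ (1 / 16 : ℝ)) := by
            gcongr
            exact h5.trans h3
        _ ≤ _ := by linarith
    calc _ ≤ (B * L) ^ n * Real.log x := by gcongr
      _ = B ^ n * L ^ ((n : ℝ) - 1) * (L * Real.log x) := by rw [mul_pow, hLn]; ring
      _ ≤ B ^ n * L ^ ((n : ℝ) - 1) * (256 * m ^ (1 / 4 : ℝ)) := by gcongr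
      _ = B ^ n * 256 * L ^ ((n : ℝ) - 1) * m ^ (1 / 4 : ℝ) := by ring
      _ ≤ _ := by
        refine mul_le_mul_of_nonneg_right (mul_le_mul_of_nonneg_right ?_ hP.le) (by positivity)
        exact le_add_of_nonneg_right (by positivity)
  · have hlog : ∀ q ∈ G, Real.log x ≤ 2 * ∑ i, Real.log (q i) := fun q hq => by
      obtain ⟨-, -, h⟩ := Finset.mem_filter.1 hq
      have hq0 : ∀ j, (0 : ℝ) < q j := fun j => by exact_mod_cast (q j).2.pos
      have hN : 0 < ∏ j, (q j : ℝ) := Finset.prod_pos fun j _ => hq0 j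
      rw [← Real.log_prod fun j _ => (hq0 j).ne']
      have h1 := Real.log_le_log hx0 h.le
      have h2 := Real.log_le_log (by positivity) hxm
      rw [Real.log_mul hN.ne' hm0.ne'] at h1
      rw [Real.log_pow] at h2
      push_cast at h2
      linarith
    have h1 : (∑ q ∈ G, ∏ j, 1 / (q j : ℝ)) * Real.log x ≤
        2 * ∑ i, ∑ q ∈ G, Real.log (q i) * ∏ j, 1 / (q j : ℝ) := by
      rw [Finset.sum_comm, Finset.sum_mul, Finset.mul_sum]
      refine Finset.sum_le_sum fun q hq => ?_
      rw [← Finset.sum_mul, ← mul_assoc, mul_comm]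
      exact mul_le_mul_of_nonneg_right (hlog q hq) (prod_one_div_nonneg q)
    have h2 : ∀ i, ∑ q ∈ G, Real.log (q i) * ∏ j, 1 / (q j : ℝ) ≤
        B ^ (n - 1) * L ^ ((n : ℝ) - 1) * ((16 + 4 * Real.log 2) * m ^ (1 / 4 : ℝ)) := by
      intro i
      obtain ⟨n, rfl⟩ : ∃ n', n = n' + 1 := ⟨n - 1, by have := i.2; omega⟩
      refine (sum_log_mul_prod_one_div_le i F hx0 hm).trans ?_
      have hlogm : 0 ≤ Real.log m := Real.log_nonneg hm
      have h3 : Real.log m ≤ 4 * m ^ (1 / 4 : ℝ) := by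
        have := Real.log_le_rpow_div hm0.le (ε := 1 / 4) (by norm_num)
        linarith
      have h4 : L ^ (((n + 1 : ℕ) : ℝ) - 1) = L ^ n := by
        rw [← Real.rpow_natCast]; congr 1; push_cast; ring
      rw [h4, Nat.add_sub_cancel, ← mul_pow]
      have h5 : Real.log 2 ≤ Real.log 2 * m ^ (1 / 4 : ℝ) := le_mul_of_one_le_right hl2.le hm4
      gcongr
      linarith
    calc _ ≤ _ := h1
      _ ≤ 2 * ∑ _i : Fin n, B ^ (n - 1) * L ^ ((n : ℝ) - 1) *
            ((16 + 4 * Real.log 2) * m ^ (1 / 4 : ℝ)) := by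
        exact mul_le_mul_of_nonneg_left (Finset.sum_le_sum fun i _ => h2 i) two_pos.le
      _ = 2 * n * B ^ (n - 1) * (16 + 4 * Real.log 2) * L ^ ((n : ℝ) - 1) * m ^ (1 / 4 : ℝ) := by
        rw [Finset.sum_const, Finset.card_univ, Fintype.card_fin, nsmul_eq_mul]; ring
      _ ≤ _ := by
        refine mul_le_mul_of_nonneg_right (mul_le_mul_of_nonneg_right ?_ hP.le) (by positivity)
        exact le_add_of_nonneg_left (by positivity)

lemma summable_primes_one_div_pow_rpow {b : ℕ} (hb : 2 ≤ b) {c : ℝ} (hc : 1 / 2 < c) :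
    Summable fun p : Nat.Primes => (((p : ℝ) ^ b) ^ c)⁻¹ := by
  have hb' : (2 : ℝ) ≤ b := by exact_mod_cast hb
  refine (Nat.Primes.summable_rpow (r := -(b * c)) |>.2 (by nlinarith)).congr fun p => ?_
  rw [Real.rpow_neg (by positivity), Real.rpow_mul (by positivity), Real.rpow_natCast]

/-- Let `ℓ, n ≥ 0` and `a_i ≥ 2` for `i = 1, …, ℓ`, and set `k = n + ∑ a_i ≥ 1`. Then there
is `C = C(k) > 0` such that for all `x ≥ 3`,
`|∑_{q_1⋯q_n ∏ p_i^{a_i} ≤ x} 1/(q_1⋯q_n ∏ p_i^{a_i}) - S_n(x) ∏ P(a_i)|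
  ≤ C (log log x)^{n-1}/log x`, the sum ranging over `(n+ℓ)`-tuples of primes. -/
theorem statement12 (ℓ n : ℕ) (a : Fin ℓ → ℕ) (ha : ∀ i, 2 ≤ a i)
    (k : ℕ) (hk : k = n + ∑ i, a i) (hk1 : 1 ≤ k) :
    ∃ C : ℝ, 0 < C ∧ ∀ x : ℝ, 3 ≤ x →
      |(∑' qp : (Fin n → Nat.Primes) × (Fin ℓ → Nat.Primes),
          if (((∏ i, (qp.1 i : ℕ)) * ∏ i, (qp.2 i : ℕ)^(a i) : ℕ) : ℝ) ≤ x then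
            (1:ℝ) / ((∏ i, ((qp.1 i : ℕ) : ℝ)) * ∏ i, ((qp.2 i : ℕ) : ℝ)^(a i))
          else 0) - Sord n x * ∏ i, primeZeta (a i)|
        ≤ C * (Real.log (Real.log x)) ^ ((n : ℝ) - 1) / Real.log x := by
  obtain ⟨C, hC, hD⟩ := exists_sum_prod_one_div_le n
  set W : (Fin ℓ → Nat.Primes) → ℝ := fun p => ∏ i, ((p i : ℕ) : ℝ) ^ (a i) with hW
  set N : (Fin n → Nat.Primes) → ℝ := fun q => ∏ i, ((q i : ℕ) : ℝ) with hN
  have hW1 : ∀ p, 1 ≤ W p := fun p => Finset.one_le_prod fun i _ =>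
    one_le_pow₀ (by exact_mod_cast (p i).2.one_lt.le)
  have hN1 : ∀ q, 1 ≤ N q := fun q => Finset.one_le_prod fun i _ => by
    exact_mod_cast (q i).2.one_lt.le
  have hW0 : ∀ p, 0 < W p := fun p => one_pos.trans_le (hW1 p)
  have hN0 : ∀ q, 0 < N q := fun q => one_pos.trans_le (hN1 q)
  have hWc : ∀ c : ℝ, 1 / 2 < c → HasSum (fun p => (W p ^ c)⁻¹)
      (∏ i, ∑' p : Nat.Primes, (((p : ℝ) ^ a i) ^ c)⁻¹) := fun c hc => by
    convert hasSum_pi_prod_of_nonneg (fun i (p : Nat.Primes) => (((p : ℝ) ^ a i) ^ c)⁻¹)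
      (fun i => summable_primes_one_div_pow_rpow (ha i) hc) (fun i p => by positivity) using 2 with p
    rw [hW, ← Real.finsetProd_rpow _ _ fun i _ => by positivity, Finset.prod_inv_distrib]
  have hZ : HasSum (fun p => 1 / W p) (∏ i, primeZeta (a i)) := by
    simpa [primeZeta] using hWc 1 (by norm_num)
  have hE := (hWc (3 / 4) (by norm_num)).summable
  refine ⟨C * (∑' p, (W p ^ (3 / 4 : ℝ))⁻¹ + 1), ?_, fun x hx => ?_⟩
  · have : 0 ≤ ∑' p, (W p ^ (3 / 4 : ℝ))⁻¹ := tsum_nonneg fun p => by have := hW0 p; positivity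
    positivity
  have hlx := one_lt_log_of_three_le hx
  have hL : 0 < Real.log (Real.log x) := Real.log_pos hlx
  have hfin : {p : Nat.Primes | (p : ℝ) ≤ x}.Finite := by
    refine Set.Finite.of_finite_image ((Set.finite_Iic ⌊x⌋₊).subset ?_)
      (Subtype.val_injective (p := Nat.Prime)).injOn
    rintro _ ⟨p, hp, rfl⟩
    exact Nat.le_floor hp
  set F : Finset Nat.Primes := hfin.toFinset
  have hF : ∀ q ∈ F, (q : ℝ) ≤ x := fun q hq => hfin.mem_toFinset.1 hq
  set Q := Fintype.piFinset fun _ : Fin n => F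
  have hQ : ∀ q, N q ≤ x → q ∈ Q := fun q hq => by
    refine Fintype.mem_piFinset.2 fun i => hfin.mem_toFinset.2 (le_trans ?_ hq)
    have : (q i : ℕ) ≤ ∏ j, (q j : ℕ) :=
      Finset.single_le_prod' (fun j _ => (q j).2.one_lt.le) (Finset.mem_univ i)
    simp only [hN]
    exact_mod_cast this
  set h : (Fin n → Nat.Primes) → (Fin ℓ → Nat.Primes) → ℝ := fun q p =>
    if N q * W p ≤ x then 1 / (N q * W p) else 0 with hh
  have hNx : ∀ q p, N q * W p ≤ x → N q ≤ x := fun q p hqp =>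
    (le_mul_of_one_le_right (hN0 q).le (hW1 p)).trans hqp
  have hsum : Summable fun z : (Fin n → Nat.Primes) × (Fin ℓ → Nat.Primes) => h z.1 z.2 := by
    have hQs : Summable fun q : Fin n → Nat.Primes => if q ∈ Q then (1 : ℝ) else 0 :=
      summable_of_ne_finset_zero (s := Q) fun q hq => if_neg hq
    refine Summable.of_nonneg_of_le (fun z => ?_) (fun z => ?_)
      (Summable.mul_of_nonneg hQs hZ.summable (fun q => ?_) fun p => ?_)
    · have := hN0 z.1
      have := hW0 z.2
      simp only [hh]
      split_ifs <;> positivity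
    · have h1 := hW0 z.2
      simp only [hh]
      by_cases hz : N z.1 * W z.2 ≤ x
      · rw [if_pos hz, if_pos (hQ _ (hNx _ _ hz)), one_mul]
        exact one_div_le_one_div_of_le h1 (le_mul_of_one_le_left h1.le (hN1 _))
      · rw [if_neg hz]
        split_ifs <;> positivity
    · simp only [Pi.zero_apply]
      split_ifs <;> norm_num
    · exact one_div_nonneg.2 (hW0 p).le
  have hlhs : (∑' qp : (Fin n → Nat.Primes) × (Fin ℓ → Nat.Primes),
      if (((∏ i, (qp.1 i : ℕ)) * ∏ i, (qp.2 i : ℕ)^(a i) : ℕ) : ℝ) ≤ x then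
        (1:ℝ) / ((∏ i, ((qp.1 i : ℕ) : ℝ)) * ∏ i, ((qp.2 i : ℕ) : ℝ)^(a i))
      else 0) = ∑ q ∈ Q, ∑' p, h q p := by
    push_cast
    refine hsum.tsum_prod.trans (tsum_eq_sum fun q hq => ?_)
    have hz : ∀ p, h q p = 0 := fun p => if_neg (mt (hNx q p) (mt (hQ q) hq))
    simp only [hz, tsum_zero]
  have hS : Sord n x = ∑ q ∈ Q, if N q ≤ x then 1 / N q else 0 := by
    rw [Sord]
    push_cast
    exact tsum_eq_sum fun q hq => if_neg (mt (hQ q) hq)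
  have hdiff : HasSum (fun p => ∑ q ∈ Q, (if N q ≤ x ∧ x < N q * W p then 1 / N q else 0) / W p)
      (Sord n x * ∏ i, primeZeta (a i) - ∑ q ∈ Q, ∑' p, h q p) := by
    rw [hS, Finset.sum_mul, ← Finset.sum_sub_distrib]
    refine hasSum_sum fun q _ => ?_
    have hq := (hZ.mul_left (if N q ≤ x then 1 / N q else 0)).sub (hsum.prod_factor q).hasSum
    refine (congrArg (HasSum · _) (funext fun p => ?_)).mpr hq
    have h1 := (hN0 q).ne'
    have h2 := (hW0 p).ne'
    by_cases hqp : N q * W p ≤ x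
    · simp only [hh, if_pos hqp, if_pos (hNx q p hqp), not_lt.2 hqp, and_false, if_false]
      field_simp
      simp
    · simp only [hh, if_neg hqp, not_le.1 hqp, and_true, sub_zero, mul_one_div]
  have hbound : ∀ p, ∑ q ∈ Q, (if N q ≤ x ∧ x < N q * W p then 1 / N q else 0) / W p ≤
      C * (Real.log (Real.log x)) ^ ((n : ℝ) - 1) / Real.log x * (W p ^ (3 / 4 : ℝ))⁻¹ := by
    intro p
    have hp := hD x (W p) hx (hW1 p) F hF
    rw [Finset.sum_filter] at hp
    have hpow : W p ^ (1 / 4 : ℝ) / W p = (W p ^ (3 / 4 : ℝ))⁻¹ := by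
      rw [← Real.rpow_neg (hW0 p).le, ← Real.rpow_sub_one (hW0 p).ne']
      norm_num
    rw [← Finset.sum_div, ← hpow, ← mul_div_assoc]
    refine div_le_div_of_nonneg_right (le_trans (le_of_eq ?_) hp) (hW0 p).le
    refine Finset.sum_congr rfl fun q _ => ?_
    simp only [hN, Finset.prod_div_distrib, Finset.prod_const_one]
  have hnonneg : ∀ p, 0 ≤ ∑ q ∈ Q, (if N q ≤ x ∧ x < N q * W p then 1 / N q else 0) / W p :=
    fun p => Finset.sum_nonneg fun q _ => by
      have := hN0 q
      have := hW0 p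
      split_ifs <;> positivity
  rw [hlhs, abs_sub_comm, abs_of_nonneg (hdiff.nonneg hnonneg)]
  refine (hasSum_le hbound hdiff (hE.hasSum.mul_left _)).trans ?_
  have hK : 0 ≤ C * (Real.log (Real.log x)) ^ ((n : ℝ) - 1) / Real.log x := by
    have := Real.rpow_pos_of_pos hL ((n : ℝ) - 1)
    positivity
  calc _ ≤ C * (Real.log (Real.log x)) ^ ((n : ℝ) - 1) / Real.log x *
        (∑' p, (W p ^ (3 / 4 : ℝ))⁻¹ + 1) := mul_le_mul_of_nonneg_left (by linarith) hK
    _ = _ := by ring
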